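/- Let G = (V,E) be a connected graph with colouring ω from colour-set C, let u,v ∈ V, let xy ∈ E be an edge, and d ∈ C. Then m(u,v,d) ≤ m(u,x,d) + m(y,v,d), where m(a,b,d) denotes the minimum number of flooding moves to link a and b in a monochromatic component of colour d. -/

import Mathlib

namespace Flood

variable {V C : Type*}

/-- Two vertices are joined by an edge inside a monochromatic class. -/
def monoAdj (G : SimpleGraph V) (ω : V → C) (a b : V) : Prop :=
  G.Adj a b ∧ ω a = ω b

/-- `u` and `v` lie in a common monochromatic component of the colouring `ω`. -/
def monoLinked (G : SimpleGraph V) (ω : V → C) (u v : V) : Prop :=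
  Relation.ReflTransGen (monoAdj G ω) u v

/-- One flooding move: recolour the monochromatic component of `v` with colour `d`. -/
noncomputable def floodMove (G : SimpleGraph V) (ω : V → C) (v : V) (d : C) : V → C :=
  fun u => @ite _ (monoLinked G ω v u) (Classical.propDecidable _) d (ω u)

/-- Apply a sequence of flooding moves. -/
noncomputable def floodSeq (G : SimpleGraph V) (ω : V → C) (S : List (V × C)) : V → C :=
  S.foldl (fun ω' m => floodMove G ω' m.1 m.2) ω

/-- The sequence `S` floods `G`, i.e. makes it monochromatic. -/
def Floods (G : SimpleGraph V) (ω : V → C) (S : List (V × C)) : Prop :=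
  ∀ a b, floodSeq G ω S a = floodSeq G ω S b

/-- Minimum number of moves needed to make `G` monochromatic. -/
noncomputable def floodCost (G : SimpleGraph V) (ω : V → C) : ℕ :=
  sInf {k | ∃ S, S.length = k ∧ Floods G ω S}

/-- Minimum number of moves needed to make `G` monochromatic in colour `d`. -/
noncomputable def floodCostIn (G : SimpleGraph V) (ω : V → C) (d : C) : ℕ :=
  sInf {k | ∃ S, S.length = k ∧ ∀ a, floodSeq G ω S a = d}

/-- The sequence `S` links `u` and `v`. -/
def Links (G : SimpleGraph V) (ω : V → C) (S : List (V × C)) (u v : V) : Prop :=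
  monoLinked G (floodSeq G ω S) u v

/-- Minimum number of moves needed to link `u` and `v`. -/
noncomputable def linkCost (G : SimpleGraph V) (ω : V → C) (u v : V) : ℕ :=
  sInf {k | ∃ S, S.length = k ∧ Links G ω S u v}

/-- Minimum number of moves needed to link `u` and `v` in a monochromatic
component of colour `d`. -/
noncomputable def linkCostIn (G : SimpleGraph V) (ω : V → C) (u v : V) (d : C) : ℕ :=
  sInf {k | ∃ S, S.length = k ∧ Links G ω S u v ∧ floodSeq G ω S u = d}

section Words

/-- `WordFloods w d k`: the word `w`, read as a coloured path, can be made monochromatic in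
colour `d` by `k` moves. -/
inductive WordFloods : List C → C → ℕ → Prop
  | nil (d : C) : WordFloods [] d 0
  | single (c : C) : WordFloods [c] c 0
  | recolor {w : List C} {c : C} {k : ℕ} (d : C) :
      WordFloods w c k → WordFloods w d (k + 1)
  | append {w₁ w₂ : List C} {d : C} {k l : ℕ} :
      WordFloods w₁ d k → WordFloods w₂ d l → WordFloods (w₁ ++ w₂) d (k + l)

/-- `WordSubst w w' n`: the word `w'` arises from `w` by replacing each letter `c` by a word that
can be flooded with `c`, at total cost `n`. -/
inductive WordSubst : List C → List C → ℕ → Prop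
  | nil : WordSubst [] [] 0
  | cons {c : C} {γ w w' : List C} {n m : ℕ} :
      WordFloods γ c n → WordSubst w w' m → WordSubst (c :: w) (γ ++ w') (n + m)

theorem WordFloods.mono {w : List C} {d : C} {k l : ℕ} (h : WordFloods w d k) (hkl : k ≤ l) :
    WordFloods w d l := by
  induction hkl with
  | refl => exact h
  | step _ ih => exact ih.recolor d

theorem WordFloods.sublist {w w' : List C} {d : C} {k : ℕ} (h : WordFloods w d k)
    (hs : w'.Sublist w) : WordFloods w' d k := by
  induction h generalizing w' with
  | nil d => rw [List.sublist_nil.1 hs]; exact .nil d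
  | single c =>
    rcases List.sublist_singleton.1 hs with rfl | rfl
    · exact .nil c
    · exact .single c
  | recolor d _ ih => exact (ih hs).recolor d
  | append _ _ ih₁ ih₂ =>
    obtain ⟨l₁, l₂, rfl, h₁, h₂⟩ := List.sublist_append_iff.1 hs
    exact (ih₁ h₁).append (ih₂ h₂)

theorem WordFloods.eq_of_mem {w : List C} {d : C} {k : ℕ} (h : WordFloods w d k) (hk : k = 0) :
    ∀ c ∈ w, c = d := by
  induction h with
  | nil => simp
  | single => simp
  | recolor => omega
  | append _ _ ih₁ ih₂ =>
    intro c hc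
    rcases List.mem_append.1 hc with hc | hc
    · exact ih₁ (by omega) c hc
    · exact ih₂ (by omega) c hc

/-- A word without repeated neighbouring letters that is flooded at no cost has at most one
letter. -/
theorem WordFloods.eq_nil_or_singleton {w : List C} {d : C} (h : WordFloods w d 0)
    (hw : w.IsChain (· ≠ ·)) : w = [] ∨ w = [d] := by
  have hd := h.eq_of_mem rfl
  match w with
  | [] => exact .inl rfl
  | [c] => exact .inr (by rw [hd c (by simp)])
  | a :: b :: t =>
    rw [List.isChain_cons_cons] at hw
    exact absurd ((hd a (by simp)).trans (hd b (by simp)).symm) hw.1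

/-- In a word without repeated neighbouring letters, some first move recolours one letter and
lowers the cost. -/
theorem WordFloods.exists_move {w : List C} {d : C} {n k : ℕ} (h : WordFloods w d n)
    (hn : n = k + 1) (hw : w.IsChain (· ≠ ·)) :
    WordFloods w d k ∨
      ∃ α c β e, w = α ++ c :: β ∧ WordFloods (α ++ e :: β) d k := by
  induction h generalizing k with
  | nil => omega
  | single => omega
  | @recolor w c j d h ih =>
    obtain rfl : k = j := by omega
    cases k with
    | zero =>
      rcases h.eq_nil_or_singleton hw with rfl | rfl
      · exact .inl (.nil d)
      · exact .inr ⟨[], c, [], d, rfl, .single d⟩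
    | succ k =>
      rcases ih rfl hw with h' | ⟨α, a, β, e, rfl, h'⟩
      · exact .inl (h'.recolor d)
      · exact .inr ⟨α, a, β, e, rfl, h'.recolor d⟩
  | @append w₁ w₂ d i j h₁ h₂ ih₁ ih₂ =>
    rcases i with _ | i
    · obtain rfl : j = k + 1 := by omega
      rcases ih₂ rfl hw.right_of_append with h | ⟨α, a, β, e, rfl, h⟩
      · exact .inl ((h₁.append h).mono (by omega))
      · refine .inr ⟨w₁ ++ α, a, β, e, by simp, ?_⟩
        simpa using h₁.append h
    · rcases ih₁ rfl hw.left_of_append with h | ⟨α, a, β, e, rfl, h⟩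
      · exact .inl ((h.append h₂).mono (by omega))
      · refine .inr ⟨α, a, β ++ w₂, e, by simp, ?_⟩
        simpa using (h.append h₂).mono (show i + j ≤ k by omega)

theorem WordSubst.exists_of_append {w₁ w₂ w' : List C} {n : ℕ} (h : WordSubst (w₁ ++ w₂) w' n) :
    ∃ u₁ u₂ n₁ n₂, w' = u₁ ++ u₂ ∧ n = n₁ + n₂ ∧ WordSubst w₁ u₁ n₁ ∧ WordSubst w₂ u₂ n₂ := by
  induction w₁ generalizing w' n with
  | nil => exact ⟨[], w', 0, n, rfl, by omega, .nil, h⟩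
  | cons c w₁ ih =>
    cases h with
    | cons hγ h =>
      obtain ⟨u₁, u₂, n₁, n₂, rfl, rfl, h₁, h₂⟩ := ih h
      exact ⟨_, u₂, _, n₂, (List.append_assoc _ _ _).symm, (Nat.add_assoc _ _ _).symm,
        .cons hγ h₁, h₂⟩

theorem WordFloods.subst {w w' : List C} {d : C} {k n : ℕ} (h : WordFloods w d k)
    (hs : WordSubst w w' n) : WordFloods w' d (k + n) := by
  induction h generalizing w' n with
  | nil d => cases hs; exact .nil d
  | single c =>
    cases hs with
    | cons hγ hs => cases hs; simpa using hγ
  | recolor d _ ih => exact ((ih hs).recolor d).mono (by omega)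
  | append _ _ ih₁ ih₂ =>
    obtain ⟨u₁, u₂, n₁, n₂, rfl, rfl, h₁, h₂⟩ := hs.exists_of_append
    exact ((ih₁ h₁).append (ih₂ h₂)).mono (by omega)

end Words

section Components

variable {G : SimpleGraph V} {ω : V → C}

theorem monoLinked.symm {a b : V} (h : monoLinked G ω a b) : monoLinked G ω b a :=
  have : Std.Symm (monoAdj G ω) := ⟨fun _ _ h => ⟨h.1.symm, h.2.symm⟩⟩
  Relation.ReflTransGen.stdSymm.symm _ _ h

theorem monoLinked.trans {a b c : V} (h : monoLinked G ω a b) (h' : monoLinked G ω b c) :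
    monoLinked G ω a c :=
  Relation.ReflTransGen.trans h h'

theorem monoLinked.refl (a : V) : monoLinked G ω a a :=
  Relation.ReflTransGen.refl

theorem monoLinked.of_adj {a b : V} (h : G.Adj a b) (hc : ω a = ω b) : monoLinked G ω a b :=
  Relation.ReflTransGen.single ⟨h, hc⟩

theorem monoLinked.color_eq {a b : V} (h : monoLinked G ω a b) : ω a = ω b := by
  induction h with
  | refl => rfl
  | tail _ h ih => exact ih.trans h.2

theorem floodMove_of_linked {a x : V} (c : C) (h : monoLinked G ω a x) :
    floodMove G ω a c x = c := by
  simp [floodMove, h]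

theorem floodMove_of_not_linked {a x : V} (c : C) (h : ¬ monoLinked G ω a x) :
    floodMove G ω a c x = ω x := by
  simp [floodMove, h]

theorem monoLinked.floodMove {x y : V} (h : monoLinked G ω x y) (a : V) (c : C) :
    monoLinked G (floodMove G ω a c) x y := by
  induction h with
  | refl => exact .refl _
  | @tail y z _ h ih =>
    refine ih.trans (.of_adj h.1 ?_)
    have hyz : monoLinked G ω y z := .of_adj h.1 h.2
    by_cases hy : monoLinked G ω a y
    · rw [floodMove_of_linked c hy, floodMove_of_linked c (hy.trans hyz)]
    · rw [floodMove_of_not_linked c hy,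
        floodMove_of_not_linked c (fun hz => hy (hz.trans hyz.symm)), h.2]

/-- Away from the recoloured component, a move creates no new links. -/
theorem monoLinked.of_floodMove {a x y : V} {c : C}
    (h : monoLinked G (Flood.floodMove G ω a c) x y)
    (hx : ¬ monoLinked G (Flood.floodMove G ω a c) a x) : monoLinked G ω x y := by
  induction h with
  | refl => exact .refl _
  | @tail y z hxy h ih =>
    have hy : ¬ monoLinked G (Flood.floodMove G ω a c) a y :=
      fun hy => hx (hy.trans (monoLinked.symm hxy))
    have hz : ¬ monoLinked G (Flood.floodMove G ω a c) a z :=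
      fun hz => hy (hz.trans (monoLinked.of_adj h.1 h.2).symm)
    have := h.2
    rw [floodMove_of_not_linked c (fun h => hy (h.floodMove a c)),
      floodMove_of_not_linked c (fun h => hz (h.floodMove a c))] at this
    exact ih.trans (.of_adj h.1 this)

/-- A vertex linked to `a` by recolouring the component of `a` with `c` was already in that
component, or in a component of colour `c` adjacent to it. -/
theorem monoLinked.or_adj_of_floodMove {a y : V} {c : C}
    (h : monoLinked G (Flood.floodMove G ω a c) a y) :
    monoLinked G ω a y ∨
      ∃ z b, monoLinked G ω a z ∧ G.Adj z b ∧ monoLinked G ω b y ∧ ω b = c := by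
  induction h with
  | refl => exact .inl (.refl _)
  | @tail y y' hay h ih =>
    by_cases hy' : monoLinked G ω a y'
    · exact .inl hy'
    right
    have hc : Flood.floodMove G ω a c y = c := by
      rw [← monoLinked.color_eq hay, floodMove_of_linked c (.refl a)]
    have hωy' : ω y' = c := by
      rw [← floodMove_of_not_linked c hy', ← h.2, hc]
    by_cases hy : monoLinked G ω a y
    · exact ⟨y, y', hy, h.1, .refl _, hωy'⟩
    · obtain ⟨z, b, hz, hzb, hby, hb⟩ := ih.resolve_left hy
      exact ⟨z, b, hz, hzb, hby.trans (.of_adj h.1 (by rw [← hby.color_eq, hb, hωy'])), hb⟩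

end Components

section Routes

variable {G : SimpleGraph V} {ω : V → C}

/-- `Route G ω u v q`: a walk from `u` to `v` through monochromatic components with
representatives `q`. -/
inductive Route (G : SimpleGraph V) (ω : V → C) : V → V → List V → Prop
  | single {u a v : V} : monoLinked G ω u a → monoLinked G ω a v → Route G ω u v [a]
  | cons {u a a' b v : V} {q : List V} : monoLinked G ω u a → monoLinked G ω a a' →
      G.Adj a' b → Route G ω b v q → Route G ω u v (a :: q)

theorem Route.of_linked {u u' v : V} {q : List V} (h : Route G ω u v q)
    (hu : monoLinked G ω u' u) : Route G ω u' v q := by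
  cases h with
  | single h₁ h₂ => exact .single (hu.trans h₁) h₂
  | cons h₁ h₂ h₃ h₄ => exact .cons (hu.trans h₁) h₂ h₃ h₄

theorem Route.append {u x y v : V} {q₁ q₂ : List V} (h₁ : Route G ω u x q₁) (hxy : G.Adj x y)
    (h₂ : Route G ω y v q₂) : Route G ω u v (q₁ ++ q₂) := by
  induction h₁ with
  | single h h' => exact .cons h h' hxy h₂
  | cons h h' hab _ ih => exact .cons h h' hab (ih hxy)

theorem Route.floodMove {u v : V} {q : List V} (h : Route G ω u v q) (a : V) (c : C) :
    Route G (floodMove G ω a c) u v q := by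
  induction h with
  | single h₁ h₂ => exact .single (h₁.floodMove a c) (h₂.floodMove a c)
  | cons h₁ h₂ h₃ _ ih => exact .cons (h₁.floodMove a c) (h₂.floodMove a c) h₃ ih

theorem Route.exists_sublist_of_mem {u v c : V} {q : List V} (h : Route G ω u v q) (hc : c ∈ q) :
    ∃ q', q'.Sublist q ∧ Route G ω c v q' := by
  induction h with
  | single h₁ h₂ =>
    obtain rfl := List.mem_singleton.1 hc
    exact ⟨_, .refl _, .single (.refl _) h₂⟩
  | cons h₁ h₂ h₃ h₄ ih =>
    rcases List.mem_cons.1 hc with rfl | hc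
    · exact ⟨_, .refl _, .cons (.refl _) h₂ h₃ h₄⟩
    · obtain ⟨q', hq', h⟩ := ih hc
      exact ⟨q', hq'.cons _, h⟩

/-- Every route can be shortened to one that visits each component at most once. -/
theorem Route.exists_pairwise {u v : V} {q : List V} (h : Route G ω u v q) :
    ∃ q', q'.Sublist q ∧ Route G ω u v q' ∧ q'.Pairwise (fun a b => ¬ monoLinked G ω a b) := by
  induction h with
  | single h₁ h₂ => exact ⟨_, .refl _, .single h₁ h₂, List.pairwise_singleton _ _⟩
  | @cons u a a' b v q h₁ h₂ h₃ _ ih =>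
    obtain ⟨l, hl, hr, hp⟩ := ih
    by_cases hx : ∃ x ∈ l, monoLinked G ω a x
    · obtain ⟨x, hxl, hax⟩ := hx
      obtain ⟨l', hl', hr'⟩ := hr.exists_sublist_of_mem hxl
      exact ⟨l', (hl'.trans hl).cons _, hr'.of_linked (h₁.trans hax), hp.sublist hl'⟩
    · push Not at hx
      exact ⟨a :: l, hl.cons_cons _, .cons h₁ h₂ h₃ hr, List.pairwise_cons.2 ⟨hx, hp⟩⟩

theorem Route.isChain_ne {u v : V} {q : List V} (h : Route G ω u v q)
    (hp : q.Pairwise (fun a b => ¬ monoLinked G ω a b)) : (q.map ω).IsChain (· ≠ ·) := by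
  induction h with
  | single => simp
  | @cons u a a' b v q h₁ h₂ h₃ h₄ ih =>
    obtain ⟨ha, hp⟩ := List.pairwise_cons.1 hp
    have aux : ∀ x t, q = x :: t → monoLinked G ω b x → ω a ≠ ω x := by
      rintro x t rfl hbx hax
      refine ha x (by simp) (h₂.trans (.trans (.of_adj h₃ ?_) hbx))
      rw [← h₂.color_eq, hax, hbx.color_eq]
    have ih := ih hp
    cases h₄ with
    | single h h' => simpa using aux _ _ rfl h
    | cons h h' _ _ => exact List.isChain_cons_cons.2 ⟨aux _ _ rfl h, ih⟩

theorem exists_route_of_walk {u v : V} (p : G.Walk u v) (ω : V → C) (d : C) :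
    ∃ q k, Route G ω u v q ∧ WordFloods (q.map ω) d k := by
  induction p with
  | nil => exact ⟨[_], 1, .single (.refl _) (.refl _), (WordFloods.single _).recolor d⟩
  | @cons u b v h _ ih =>
    obtain ⟨q, k, hr, hw⟩ := ih
    exact ⟨u :: q, 1 + k, .cons (.refl _) (.refl _) h hr,
      ((WordFloods.single (ω u)).recolor d).append hw⟩

/-- A flooding certificate for a route yields a sequence of moves in the graph. -/
theorem Route.exists_floodSeq {u v : V} {d : C} {k : ℕ} {q : List V} (h : Route G ω u v q)
    (hw : WordFloods (q.map ω) d k) :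
    ∃ S : List (V × C), S.length ≤ k ∧ Links G ω S u v ∧ floodSeq G ω S u = d := by
  induction k generalizing ω q with
  | zero =>
    obtain ⟨q', hq', hr, hp⟩ := h.exists_pairwise
    refine ⟨[], le_rfl, ?_⟩
    rcases (hw.sublist (hq'.map ω)).eq_nil_or_singleton (hr.isChain_ne hp) with hq | hq
    · cases hr <;> simp at hq
    · cases hr with
      | single h₁ h₂ =>
        exact ⟨h₁.trans h₂, h₁.color_eq.trans (by simpa using hq)⟩
      | cons _ _ _ h => cases h <;> simp at hq
  | succ k ih =>
    obtain ⟨q', hq', hr, hp⟩ := h.exists_pairwise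
    rcases (hw.sublist (hq'.map ω)).exists_move rfl (hr.isChain_ne hp) with
      hw | ⟨α, c, β, e, hq, hw⟩
    · obtain ⟨S, hS, h⟩ := ih hr hw
      exact ⟨S, by omega, h⟩
    · obtain ⟨q₁, q₂, rfl, rfl, hq₂⟩ := List.map_eq_append_iff.1 hq
      obtain ⟨a, q₃, rfl, rfl, rfl⟩ := List.map_eq_cons_iff.1 hq₂
      obtain ⟨_, hp₂, hp₁⟩ := List.pairwise_append.1 hp
      obtain ⟨hp₂, _⟩ := List.pairwise_cons.1 hp₂
      have e₁ : q₁.map (Flood.floodMove G ω a e) = q₁.map ω :=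
        List.map_congr_left fun x hx =>
          floodMove_of_not_linked e fun hax => hp₁ x hx a (by simp) hax.symm
      have e₂ : q₃.map (Flood.floodMove G ω a e) = q₃.map ω :=
        List.map_congr_left fun x hx => floodMove_of_not_linked e (hp₂ x hx)
      obtain ⟨S, hS, h⟩ := ih (hr.floodMove a e) (by
        rw [List.map_append, List.map_cons, e₁, e₂, floodMove_of_linked e (.refl a)]
        exact hw)
      exact ⟨(a, e) :: S, by simpa using hS, h⟩

/-- A component merged by a move with `a` is crossed by a route of the old colouring of
cost `1`. -/
theorem exists_route_of_linked_floodMove {a x y : V} {c : C}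
    (hx : monoLinked G (floodMove G ω a c) a x) (hy : monoLinked G (floodMove G ω a c) a y) :
    ∃ q, Route G ω x y q ∧ WordFloods (q.map ω) c 1 := by
  have ha : WordFloods [ω a] c 1 := (WordFloods.single _).recolor c
  obtain ⟨q, hr, hw⟩ : ∃ q, Route G ω a y q ∧ WordFloods (q.map ω) c 1 := by
    rcases hy.or_adj_of_floodMove with hy | ⟨z, b, hz, hzb, hby, rfl⟩
    · exact ⟨[a], .single (.refl _) hy, ha⟩
    · exact ⟨[a, b], .cons (.refl _) hz hzb (.single (.refl _) hby), ha.append (.single _)⟩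
  rcases hx.or_adj_of_floodMove with hx | ⟨z, b, hz, hzb, hbx, rfl⟩
  · exact ⟨q, hr.of_linked hx.symm, hw⟩
  · exact ⟨b :: q, .cons hbx.symm (.refl _) hzb.symm (hr.of_linked hz.symm),
      ((WordFloods.single _).append hw).mono (by omega)⟩

/-- A route after a move, visiting each component at most once, expands to a route before it. -/
theorem Route.exists_wordSubst {a u v : V} {c : C} {q : List V}
    (h : Route G (Flood.floodMove G ω a c) u v q)
    (hp : q.Pairwise (fun x y => ¬ monoLinked G (Flood.floodMove G ω a c) x y)) :
    ∃ q' n, Route G ω u v q' ∧ WordSubst (q.map (Flood.floodMove G ω a c)) (q'.map ω) n ∧ n ≤ 1 ∧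
      ((∀ x ∈ q, ¬ monoLinked G (Flood.floodMove G ω a c) a x) → n = 0) := by
  have key : ∀ {x s y : V}, monoLinked G (Flood.floodMove G ω a c) x s →
      monoLinked G (Flood.floodMove G ω a c) s y →
      ∃ q' n, Route G ω x y q' ∧
        WordFloods (q'.map ω) (Flood.floodMove G ω a c s) n ∧ n ≤ 1 ∧
        (¬ monoLinked G (Flood.floodMove G ω a c) a s → n = 0) := by
    intro x s y hx hy
    by_cases hs : monoLinked G (Flood.floodMove G ω a c) a s
    · obtain ⟨q', hr, hw⟩ := exists_route_of_linked_floodMove (hs.trans hx.symm) (hs.trans hy)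
      refine ⟨q', 1, hr, ?_, le_rfl, fun h => absurd hs h⟩
      rwa [← hs.color_eq, floodMove_of_linked c (.refl a)]
    · refine ⟨[s], 0, .single (hx.symm.of_floodMove hs).symm (hy.of_floodMove hs), ?_,
        Nat.zero_le _, fun _ => rfl⟩
      rw [floodMove_of_not_linked c (fun h => hs (h.floodMove a c))]
      exact .single _
  induction h with
  | single h₁ h₂ =>
    obtain ⟨q', n, hr, hw, hn, hn'⟩ := key h₁ h₂
    exact ⟨q', n, hr, by simpa using WordSubst.cons hw .nil, hn,
      fun h => hn' (h _ (by simp))⟩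
  | @cons u s s' b v q h₁ h₂ h₃ _ ih =>
    obtain ⟨hs, hp⟩ := List.pairwise_cons.1 hp
    obtain ⟨q₁, n₁, hr₁, hw₁, hn₁, hn₁'⟩ := key h₁ h₂
    obtain ⟨q₂, n₂, hr₂, hw₂, hn₂, hn₂'⟩ := ih hp
    refine ⟨q₁ ++ q₂, n₁ + n₂, hr₁.append h₃ hr₂, ?_, ?_, fun h => ?_⟩
    · simpa using WordSubst.cons hw₁ hw₂
    · by_cases has : monoLinked G (Flood.floodMove G ω a c) a s
      · have := hn₂' fun x hx hax => hs x hx (has.symm.trans hax)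
        omega
      · have := hn₁' has
        omega
    · rw [hn₁' (h s (by simp)), hn₂' fun x hx => h x (by simp [hx])]

/-- A linking sequence of moves yields a route together with a flooding certificate. -/
theorem exists_route_of_links {u v : V} {d : C} (S : List (V × C)) (h : Links G ω S u v)
    (hd : floodSeq G ω S u = d) :
    ∃ q, Route G ω u v q ∧ WordFloods (q.map ω) d S.length := by
  induction S generalizing ω with
  | nil =>
    subst hd
    exact ⟨[u], .single (.refl _) h, .single _⟩
  | cons m S ih =>
    obtain ⟨q, hr, hw⟩ := ih (ω := floodMove G ω m.1 m.2) h hd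
    obtain ⟨q₁, hq₁, hr₁, hp⟩ := hr.exists_pairwise
    obtain ⟨q₂, n, hr₂, hs, hn, -⟩ := hr₁.exists_wordSubst hp
    exact ⟨q₂, hr₂, ((hw.sublist (hq₁.map _)).subst hs).mono (by simpa using hn)⟩

/-- In a connected graph the minimum defining `linkCostIn` is attained. -/
theorem exists_links_length_eq_linkCostIn (hG : G.Connected) (ω : V → C) (u v : V) (d : C) :
    ∃ S : List (V × C), S.length = linkCostIn G ω u v d ∧ Links G ω S u v ∧
      floodSeq G ω S u = d := by
  obtain ⟨p⟩ := hG.preconnected u v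
  obtain ⟨q, k, hr, hw⟩ := exists_route_of_walk p ω d
  obtain ⟨S, -, hS⟩ := hr.exists_floodSeq hw
  exact Nat.sInf_mem
    (s := {k | ∃ S : List (V × C), S.length = k ∧ Links G ω S u v ∧ floodSeq G ω S u = d})
    ⟨S.length, S, rfl, hS⟩

end Routes

end Flood

open Flood

/-- triangle inequality across an edge: for an edge `xy` of `G`,
`m(u,v,d) ≤ m(u,x,d) + m(y,v,d)`. -/
theorem linkCost_triangle {V C : Type*}
    (G : SimpleGraph V) (hG : G.Connected) (ω : V → C)
    (u v x y : V) (hxy : G.Adj x y) (d : C) :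
    linkCostIn G ω u v d ≤ linkCostIn G ω u x d + linkCostIn G ω y v d := by
  obtain ⟨S₁, hS₁, hl₁, hd₁⟩ := exists_links_length_eq_linkCostIn hG ω u x d
  obtain ⟨S₂, hS₂, hl₂, hd₂⟩ := exists_links_length_eq_linkCostIn hG ω y v d
  obtain ⟨q₁, hr₁, hw₁⟩ := exists_route_of_links S₁ hl₁ hd₁
  obtain ⟨q₂, hr₂, hw₂⟩ := exists_route_of_links S₂ hl₂ hd₂
  obtain ⟨S, hS, h⟩ := (hr₁.append hxy hr₂).exists_floodSeq
    (by rw [List.map_append]; exact hw₁.append hw₂)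
  rw [← hS₁, ← hS₂]
  exact le_trans (Nat.sInf_le ⟨S, rfl, h⟩) hS
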